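/- There is no integral weight matrix Θ ∈ M_{3×4}(ℤ) such that all four 3×3 minors Δ_{αβγ} are nonzero and all eight determinants ^{1±2}□^{1±3}_{1±4} belong to {1, −1}. (This is the arithmetic content of Proposition 1.2: the action of Sp(1)×T³_Θ on N(Θ) is never free.) -/

import Mathlib

noncomputable section

/-- The 3×3 minor `Δ_{αβγ}` of the weight matrix with rows `p, q, l`. -/
def Δ (p q l : Fin 4 → ℤ) (α β γ : Fin 4) : ℤ :=
  Matrix.det !![p α, q α, l α; p β, q β, l β; p γ, q γ, l γ]

/-- The determinant `^{1±2}□^{1±3}_{1±4}` with signs `s₂, s₃, s₄ ∈ {1, -1}`. -/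
def box (p q l : Fin 4 → ℤ) (s₂ s₃ s₄ : ℤ) : ℤ :=
  Matrix.det !![p 0 + s₂ * p 1, q 0 + s₂ * q 1, l 0 + s₂ * l 1;
                p 0 + s₃ * p 2, q 0 + s₃ * q 2, l 0 + s₃ * l 2;
                p 0 + s₄ * p 3, q 0 + s₄ * q 3, l 0 + s₄ * l 3]

/-- arithmetic content of Proposition 1.2: there is no integral weight
matrix `Θ ∈ M_{3×4}(ℤ)` whose four minors `Δ_{αβγ}` are all nonzero and whose eight
determinants `^{1±2}□^{1±3}_{1±4}` all lie in `{1, -1}`. -/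
theorem statement3 :
    ¬ ∃ p q l : Fin 4 → ℤ,
      (∀ α β γ : Fin 4, α < β → β < γ → Δ p q l α β γ ≠ 0) ∧
      (∀ s₂ s₃ s₄ : ℤ, s₂ ∈ ({1, -1} : Set ℤ) → s₃ ∈ ({1, -1} : Set ℤ) →
        s₄ ∈ ({1, -1} : Set ℤ) → box p q l s₂ s₃ s₄ ∈ ({1, -1} : Set ℤ)) := by
  rintro ⟨p, q, l, hΔ, hbox⟩
  have hA := hΔ 0 2 3 (by decide) (by decide)
  have hB := hΔ 0 1 3 (by decide) (by decide)
  have hC := hΔ 0 1 2 (by decide) (by decide)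
  have hD := hΔ 1 2 3 (by decide) (by decide)
  -- Expand each box determinant by multilinearity in terms of the four minors.
  have key : ∀ a b c : ℤ, box p q l a b c =
      b * c * Δ p q l 0 2 3 - a * c * Δ p q l 0 1 3 + a * b * Δ p q l 0 1 2
        + a * b * c * Δ p q l 1 2 3 := by
    intro a b c
    simp only [box, Δ, Matrix.det_fin_three, Matrix.of_apply, Matrix.cons_val]
    ring
  simp only [key, Set.mem_insert_iff, Set.mem_singleton_iff] at hbox
  generalize Δ p q l 0 2 3 = A at *
  generalize Δ p q l 0 1 3 = B at *
  generalize Δ p q l 0 1 2 = C at *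
  generalize Δ p q l 1 2 3 = D at *
  have h1 := hbox 1 1 1 (by simp) (by simp) (by simp)
  have h2 := hbox 1 1 (-1) (by simp) (by simp) (by simp)
  have h3 := hbox 1 (-1) 1 (by simp) (by simp) (by simp)
  have h4 := hbox 1 (-1) (-1) (by simp) (by simp) (by simp)
  have h5 := hbox (-1) 1 1 (by simp) (by simp) (by simp)
  have h6 := hbox (-1) 1 (-1) (by simp) (by simp) (by simp)
  have h7 := hbox (-1) (-1) 1 (by simp) (by simp) (by simp)
  have h8 := hbox (-1) (-1) (-1) (by simp) (by simp) (by simp)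
  clear hbox key hΔ
  omega
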